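/- arXiv:1308.6348 — 2 statements merged into one kernel-verified Lean document; each statement's English description precedes it below -/
import Mathlib

section
/- Let R be an incline and x, y two regular elements of R. Then both x*y and y*x are regular if and only if x*y = y*x. -/
/-- An incline: a nonempty set with `+` and `*` such that `(R,+)` is a commutative
semigroup, `(R,*)` is a semigroup, `*` distributes over `+` from both sides,
addition is idempotent, and `x + x*y = x`, `x + y*x = x` for all `x y`.
(Nonemptiness is assumed via `Nonempty R` where needed.) -/
class Incline (R : Type*) extends Add R, Mul R where
  add_comm : ∀ x y : R, x + y = y + x
  add_assoc : ∀ x y z : R, x + y + z = x + (y + z)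
  mul_assoc : ∀ x y z : R, x * y * z = x * (y * z)
  left_distrib : ∀ x y z : R, x * (y + z) = x * y + x * z
  right_distrib : ∀ x y z : R, (x + y) * z = x * z + y * z
  add_idem : ∀ x : R, x + x = x
  add_absorb_mul_left : ∀ x y : R, x + x * y = x
  add_absorb_mul_right : ∀ x y : R, x + y * x = x

/-- An element `a` of an incline is regular if `a * z * a = a` for some `z`. -/
def Incline.IsRegular {R : Type*} [Incline R] (a : R) : Prop :=
  ∃ z : R, a * z * a = a

namespace Incline

variable {R : Type*} [Incline R]

theorem mul_add_left_factor (a b : R) : a * b + a = a := by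
  rw [Incline.add_comm, add_absorb_mul_left]

theorem mul_add_right_factor (a b : R) : a * b + b = b := by
  rw [Incline.add_comm, add_absorb_mul_right]

/-- In the order `a ≤ b ↔ a + b = b`, inserting a middle factor decreases a product. -/
theorem mul_mul_add_mul (a z b : R) : a * z * b + a * b = a * b := by
  rw [← right_distrib, mul_add_left_factor]

/-- Regular elements of an incline are idempotent. -/
theorem IsRegular.mul_self {a : R} (ha : IsRegular a) : a * a = a := by
  obtain ⟨z, hz⟩ := ha
  have h := mul_mul_add_mul a z a
  rw [hz, add_absorb_mul_left] at h
  exact h.symm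

theorem isRegular_of_mul_self {a : R} (ha : a * a = a) : IsRegular a :=
  ⟨a, by rw [ha, ha]⟩

/-- If `x * y` is regular, then `x * y ≤ y * x`, where `a ≤ b` means `a + b = b`. -/
theorem IsRegular.mul_add_mul_swap {x y : R} (h : IsRegular (x * y)) :
    x * y + y * x = y * x := by
  have hxy : x * y = x * (y * x * y) := by
    rw [Incline.mul_assoc y, ← Incline.mul_assoc, h.mul_self]
  calc x * y + y * x = x * (y * x * y) + y * x := by rw [← hxy]
    _ = x * (y * x * y) + (y * x * y + y * x) := by rw [mul_add_left_factor (y * x)]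
    _ = y * x := by
      rw [← Incline.add_assoc, mul_add_right_factor, mul_add_left_factor]

end Incline

theorem incline_both_regular_iff_comm {R : Type*} [Incline R] (x y : R)
    (hx : Incline.IsRegular x) (hy : Incline.IsRegular y) :
    (Incline.IsRegular (x * y) ∧ Incline.IsRegular (y * x)) ↔ x * y = y * x := by
  constructor
  · rintro ⟨hxy, hyx⟩
    rw [← hyx.mul_add_mul_swap, Incline.add_comm, hxy.mul_add_mul_swap]
  · intro h
    have hr : Incline.IsRegular (x * y) := by
      apply Incline.isRegular_of_mul_self
      calc x * y * (x * y) = x * (y * x) * y := by simp only [Incline.mul_assoc]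
        _ = x * x * (y * y) := by rw [← h]; simp only [Incline.mul_assoc]
        _ = x * y := by rw [hx.mul_self, hy.mul_self]
    exact ⟨hr, h ▸ hr⟩
end

section
/- In a regular incline R, the incline order is characterized by multiplication: for all x, y in R, x ≤ y if and only if x*y = x. -/
/-- A regular element of an incline is idempotent. -/
theorem Incline.IsRegular.mul_self_s17 {R : Type*} [Incline R] {a : R}
    (ha : Incline.IsRegular a) : a * a = a := by
  obtain ⟨z, hz⟩ := ha
  have h : a * z = a := by
    have h₁ := Incline.add_absorb_mul_left (a * z) a
    rw [hz, Incline.add_comm, Incline.add_absorb_mul_left] at h₁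
    exact h₁.symm
  rwa [h] at hz

theorem regular_incline_le_iff_mul {R : Type*} [Incline R] [Nonempty R]
    (hreg : ∀ a : R, Incline.IsRegular a) :
    ∀ x y : R, x + y = y ↔ x * y = x := by
  intro x y
  constructor
  · intro h
    rw [← h, Incline.left_distrib, (hreg x).mul_self_s17, Incline.add_absorb_mul_left]
  · intro h
    rw [Incline.add_comm]
    nth_rewrite 1 [← h]
    exact Incline.add_absorb_mul_right y x
end
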